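/- Let F be any field, M an M_d-matrix over F, p ∈ (F^n)^d, and set r = rank M(p) (the rank of the scalar evaluation). Then there exists an M_d-matrix N of the same dimensions as M such that PR(M − N) ≤ 2^d · r and CR(N) ≤ ∑_{S ⊊ {1,…,d}} (CR(M[p_S]) − r), where the sum ranges over all proper subsets S of {1,…,d} (including the empty set). -/

import Mathlib

open MvPolynomial

section Defs

variable {F : Type*} [Field F]

/-- A polynomial in the block variables `x_{i,j}` (`i ∈ Fin d`, `j ∈ Fin n`) is
multilinear exactly in the blocks of `S`: every monomial has degree 1 in each block
`i ∈ S` and degree 0 in each block `i ∉ S`. -/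
def IsMultilinearOn {d n : ℕ} (S : Finset (Fin d))
    (f : MvPolynomial (Fin d × Fin n) F) : Prop :=
  ∀ m ∈ f.support, ∀ i : Fin d,
    (∑ j : Fin n, m (i, j)) = if i ∈ S then 1 else 0

/-- A multilinear form: degree 1 in every block of variables. -/
def IsMultilinear {d n : ℕ} (f : MvPolynomial (Fin d × Fin n) F) : Prop :=
  IsMultilinearOn Finset.univ f

/-- Commutative rank: the rank of the matrix over the field of fractions of the
polynomial ring. -/
noncomputable def CR {σ : Type*} {α β : Type*} [Fintype β]
    (M : Matrix α β (MvPolynomial σ F)) : ℕ :=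
  (M.map (algebraMap (MvPolynomial σ F) (FractionRing (MvPolynomial σ F)))).rank

/-- `M` is the sum of `r` outer products `u ⊗ v`, where `u` has entries multilinear
in the blocks of some `S ⊆ [d]` and `v` has entries multilinear in the complementary
blocks. -/
def HasPRDecomp {d n a b : ℕ}
    (M : Matrix (Fin a) (Fin b) (MvPolynomial (Fin d × Fin n) F)) (r : ℕ) : Prop :=
  ∃ (S : Fin r → Finset (Fin d))
    (u : Fin r → Fin a → MvPolynomial (Fin d × Fin n) F)
    (v : Fin r → Fin b → MvPolynomial (Fin d × Fin n) F),
    (∀ t i, IsMultilinearOn (S t) (u t i)) ∧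
    (∀ t j, IsMultilinearOn (S t)ᶜ (v t j)) ∧
    M = ∑ t, Matrix.of fun i j => u t i * v t j

/-- Partition rank of a matrix of multilinear forms. -/
noncomputable def PR {d n a b : ℕ}
    (M : Matrix (Fin a) (Fin b) (MvPolynomial (Fin d × Fin n) F)) : ℕ :=
  sInf {r | HasPRDecomp M r}

/-- Evaluation of a matrix of multilinear forms at a point `p ∈ (F^n)^d`. -/
noncomputable def evalMat {d n : ℕ} {α β : Type*}
    (M : Matrix α β (MvPolynomial (Fin d × Fin n) F)) (p : Fin d → Fin n → F) :
    Matrix α β F :=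
  M.map (eval fun v => p v.1 v.2)

/-- Max-rank: the largest rank of a scalar evaluation. -/
noncomputable def MaxR {d n : ℕ} {α β : Type*} [Fintype β]
    (M : Matrix α β (MvPolynomial (Fin d × Fin n) F)) : ℕ :=
  ⨆ p : Fin d → Fin n → F, (evalMat M p).rank

/-- Partial evaluation: substitute `x_i := p_i` for `i ∈ S`, leaving the other
blocks of variables untouched. -/
noncomputable def pevalMat {d n : ℕ} {α β : Type*}
    (M : Matrix α β (MvPolynomial (Fin d × Fin n) F)) (S : Finset (Fin d))
    (p : Fin d → Fin n → F) :
    Matrix α β (MvPolynomial (Fin d × Fin n) F) :=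
  M.map (aeval fun v : Fin d × Fin n => if v.1 ∈ S then C (p v.1 v.2) else X v)

end Defs

section D1

variable {F : Type*} [Field F]

/-- Partition-rank decomposition for matrices of linear forms: a sum of `r` outer
products, each either (scalars) ⊗ (linear forms) or (linear forms) ⊗ (scalars). -/
def HasPR1Decomp {n a b : ℕ}
    (M : Matrix (Fin a) (Fin b) (MvPolynomial (Fin n) F)) (r : ℕ) : Prop :=
  ∃ (c : Fin r → Bool)
    (u : Fin r → Fin a → MvPolynomial (Fin n) F)
    (v : Fin r → Fin b → MvPolynomial (Fin n) F),
    (∀ t i, (u t i).IsHomogeneous (if c t then 0 else 1)) ∧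
    (∀ t j, (v t j).IsHomogeneous (if c t then 1 else 0)) ∧
    M = ∑ t, Matrix.of fun i j => u t i * v t j

/-- Partition rank of a matrix of linear forms. -/
noncomputable def PR1 {n a b : ℕ}
    (M : Matrix (Fin a) (Fin b) (MvPolynomial (Fin n) F)) : ℕ :=
  sInf {r | HasPR1Decomp M r}

/-- Max-rank of a matrix of linear forms. -/
noncomputable def MaxR1 {n a b : ℕ}
    (M : Matrix (Fin a) (Fin b) (MvPolynomial (Fin n) F)) : ℕ :=
  ⨆ p : Fin n → F, (M.map (eval p)).rank

end D1

section Tensor3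

variable {F : Type*} [Field F]

/-- Substitute the first two blocks of variables of a trilinear form at `x` and `y`,
leaving a polynomial in the third block. -/
noncomputable def sub01 {n : ℕ} (T : MvPolynomial (Fin 3 × Fin n) F)
    (x y : Fin n → F) : MvPolynomial (Fin 3 × Fin n) F :=
  aeval (fun v : Fin 3 × Fin n =>
    if v.1 = 0 then C (x v.2) else if v.1 = 1 then C (y v.2) else X v) T

open Classical in
/-- The bias of a 3-tensor: the probability over `(x, y)` that `T(x, y, -)` is the
zero linear form. -/
noncomputable def bias {n : ℕ} [Fintype F] (T : MvPolynomial (Fin 3 × Fin n) F) : ℝ :=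
  ((Finset.univ.filter fun p : (Fin n → F) × (Fin n → F) =>
      sub01 T p.1 p.2 = 0).card : ℝ) /
    ((Fintype.card ((Fin n → F) × (Fin n → F))) : ℝ)

/-- The analytic rank of a 3-tensor. -/
noncomputable def AR {n : ℕ} [Fintype F] (T : MvPolynomial (Fin 3 × Fin n) F) : ℝ :=
  - Real.logb (Fintype.card F) (bias T)

/-- A slice-rank decomposition: `T = ∑ f_t g_t` with `f_t` a linear form in one
block and `g_t` a bilinear form in the other two blocks. -/
def HasSRDecomp {n : ℕ} (T : MvPolynomial (Fin 3 × Fin n) F) (r : ℕ) : Prop :=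
  ∃ (c : Fin r → Fin 3) (f g : Fin r → MvPolynomial (Fin 3 × Fin n) F),
    (∀ t, IsMultilinearOn {c t} (f t)) ∧
    (∀ t, IsMultilinearOn ({c t} : Finset (Fin 3))ᶜ (g t)) ∧
    T = ∑ t, f t * g t

/-- Slice rank of a 3-tensor. -/
noncomputable def SR {n : ℕ} (T : MvPolynomial (Fin 3 × Fin n) F) : ℕ :=
  sInf {r | HasSRDecomp T r}

/-- The matrix `mat T` of a 3-tensor, evaluated at `x` in its first block:
the `(j,k)` entry is `T(x, e_j, e_k)`. -/
noncomputable def matT {n : ℕ} (T : MvPolynomial (Fin 3 × Fin n) F)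
    (x : Fin n → F) : Matrix (Fin n) (Fin n) F :=
  Matrix.of fun j k => eval (fun v : Fin 3 × Fin n =>
    if v.1 = 0 then x v.2
    else if v.1 = 1 then (if v.2 = j then 1 else 0)
    else (if v.2 = k then 1 else 0)) T

end Tensor3

section Mult

variable {F : Type*} [Field F]

/-- `mult(f, p)`: the minimum total degree of a monomial of `f(x + p)`. -/
noncomputable def polyMult {n : ℕ} (f : MvPolynomial (Fin n) F) (p : Fin n → F) : ℕ :=
  sInf {k | ∃ m ∈ (aeval (fun i : Fin n => X i + C (p i)) f :
    MvPolynomial (Fin n) F).support, (∑ i, m i) = k}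

end Mult

section LA
theorem aux_select {K V : Type*} [Field K] [AddCommGroup V] [Module K V] {a r : ℕ}
    (v : Fin a → V) (h : Module.finrank K (Submodule.span K (Set.range v)) = r) :
    ∃ e : Fin r → Fin a, LinearIndependent K (v ∘ e) := by
  obtain ⟨κ, g, hg, hs, hl⟩ := exists_linearIndependent' K v
  have : Finite κ := Finite.of_injective g hg
  have := Fintype.ofFinite κ
  have hc := finrank_span_eq_card hl
  rw [hs, h] at hc
  let q : Fin r ≃ κ := (finCongr hc).trans (Fintype.equivFin κ).symm
  exact ⟨g ∘ q, by simpa [Function.comp_assoc] using hl.comp q q.injective⟩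

theorem aux_minor {K : Type*} [Field K] {a b r : ℕ} (A : Matrix (Fin a) (Fin b) K)
    (h : A.rank = r) : ∃ (e : Fin r → Fin a) (f : Fin r → Fin b), (A.submatrix e f).det ≠ 0 := by
  rw [Matrix.rank_eq_finrank_span_row] at h
  obtain ⟨e, he⟩ := aux_select _ h
  have h2 : (A.submatrix e id).rank = r := by
    simpa using LinearIndependent.rank_matrix (M := A.submatrix e id) he
  rw [Matrix.rank_eq_finrank_span_cols] at h2
  obtain ⟨f, hf⟩ := aux_select _ h2
  refine ⟨e, f, ?_⟩
  have := (Matrix.linearIndependent_cols_iff_isUnit (A := A.submatrix e f)).1 hf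
  rw [Matrix.isUnit_iff_isUnit_det] at this
  exact this.ne_zero

/-- a nonzero minor bounds the rank from below -/
theorem aux_minor_le {K : Type*} [Field K] {a b r : ℕ} (A : Matrix (Fin a) (Fin b) K)
    (e : Fin r → Fin a) (f : Fin r → Fin b) (h : (A.submatrix e f).det ≠ 0) : r ≤ A.rank := by
  have h1 := Matrix.rank_of_det_ne_zero h
  have h2 := Matrix.rank_submatrix_le A e f
  simp at h1
  omega

/-- rank does not increase under ring homomorphisms -/
theorem aux_rank_map {A B K L : Type*} [CommRing A] [CommRing B] [Field K] [Field L]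
    (i : A →+* K) (hi : Function.Injective i) (j : B →+* L) (φ : A →+* B) {a b : ℕ}
    (M : Matrix (Fin a) (Fin b) A) :
    ((M.map φ).map j).rank ≤ (M.map i).rank := by
  obtain ⟨e, f, h⟩ := aux_minor ((M.map φ).map j) rfl
  apply aux_minor_le _ e f
  have h1 : (((M.map φ).map j).submatrix e f) = (j.comp φ).mapMatrix (M.submatrix e f) := by
    ext; simp
  have h2 : (M.map i).submatrix e f = i.mapMatrix (M.submatrix e f) := by
    ext; simp
  rw [h1, ← RingHom.map_det] at h
  rw [h2, ← RingHom.map_det]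
  intro h0
  rw [map_eq_zero_iff i hi] at h0
  simp [h0] at h

/-- Wedderburn rank reduction -/
theorem aux_wedderburn {K : Type*} [Field K] {a b r : ℕ} (M : Matrix (Fin a) (Fin b) K)
    (e : Fin r → Fin a) (f : Fin r → Fin b) (E : Matrix (Fin r) (Fin r) K)
    (hE : M.submatrix e f * E = 1) :
    (M - M.submatrix id f * E * M.submatrix e id).rank + r ≤ M.rank := by
  set S := M - M.submatrix id f * E * M.submatrix e id with hS
  let P : (Fin a → K) →ₗ[K] (Fin r → K) := LinearMap.funLeft K K e
  let W := LinearMap.range M.mulVecLin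
  let PW := P.comp W.subtype
  have key := LinearMap.finrank_range_add_finrank_ker PW
  have hf : M.submatrix id f = M * (1 : Matrix (Fin b) (Fin b) K).submatrix id f := by
    ext i j; simp [Matrix.mul_apply, Matrix.one_apply]
  have hsurj : LinearMap.range PW = ⊤ := by
    rw [LinearMap.range_eq_top]
    intro y
    refine ⟨⟨(M.submatrix id f * E).mulVec y, ?_⟩, ?_⟩
    · refine ⟨((1 : Matrix (Fin b) (Fin b) K).submatrix id f * E).mulVec y, ?_⟩
      rw [hf]; simp [Matrix.mul_assoc]
    · have : P ((M.submatrix id f * E).mulVec y) = (M.submatrix e f * E).mulVec y := by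
        ext k; simp [P, LinearMap.funLeft_apply, Matrix.mulVec, dotProduct, Matrix.mul_apply]
      simp only [PW, LinearMap.comp_apply, Submodule.subtype_apply]
      rw [this, hE, Matrix.one_mulVec]
  have hker : S.rank ≤ Module.finrank K (LinearMap.ker PW) := by
    have : LinearMap.range S.mulVecLin ≤ (LinearMap.ker PW).map W.subtype := by
      rintro _ ⟨y, rfl⟩
      have hW : S.mulVecLin y ∈ W := by
        refine ⟨y - ((1 : Matrix (Fin b) (Fin b) K).submatrix id f * E * M.submatrix e id).mulVec y, ?_⟩
        rw [hS, hf]; simp [Matrix.mul_assoc, Matrix.mulVec_sub]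
      refine ⟨⟨_, hW⟩, ?_, rfl⟩
      have h0 : S.submatrix e id = 0 := by
        have : S.submatrix e id = M.submatrix e id - (M.submatrix e f * E) * M.submatrix e id := by
          ext; simp [hS, Matrix.mul_apply]
        rw [this, hE]; simp
      have : P (S.mulVecLin y) = (S.submatrix e id).mulVec y := by
        ext k; simp [P, LinearMap.funLeft_apply, Matrix.mulVec, dotProduct]
      simp only [SetLike.mem_coe, LinearMap.mem_ker, PW, LinearMap.comp_apply, Submodule.subtype_apply]
      rw [this, h0]; simp
    have h1 := Submodule.finrank_mono this
    exact h1.trans (Submodule.finrank_map_le _ _)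
  rw [hsurj] at key
  simp at key
  have : M.rank = Module.finrank K W := rfl
  omega

theorem aux_rank_add {K : Type*} [Field K] {a b : ℕ}
    (A B : Matrix (Fin a) (Fin b) K) : (A + B).rank ≤ A.rank + B.rank := by
  have : LinearMap.range (A + B).mulVecLin ≤
      LinearMap.range A.mulVecLin ⊔ LinearMap.range B.mulVecLin := by
    rintro _ ⟨y, rfl⟩
    simp only [Matrix.mulVecLin_add, LinearMap.add_apply]
    exact Submodule.add_mem_sup ⟨y, rfl⟩ ⟨y, rfl⟩
  exact (Submodule.finrank_mono this).trans (Submodule.finrank_add_le_finrank_add_finrank _ _)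

theorem aux_rank_sum {K ι : Type*} [Field K] {a b : ℕ} (s : Finset ι)
    (f : ι → Matrix (Fin a) (Fin b) K) : (∑ i ∈ s, f i).rank ≤ ∑ i ∈ s, (f i).rank := by
  classical
  induction s using Finset.induction_on with
  | empty => simp
  | insert x s hx ih =>
    rw [Finset.sum_insert hx, Finset.sum_insert hx]
    exact (aux_rank_add _ _).trans (by omega)

theorem aux_rank_smul {K : Type*} [Field K] {a b : ℕ} (c : K)
    (M : Matrix (Fin a) (Fin b) K) : (c • M).rank ≤ M.rank := by
  have : c • M = (c • (1 : Matrix (Fin a) (Fin a) K)) * M := by simp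
  rw [this]; exact Matrix.rank_mul_le_right _ _
end LA

section PS
variable {F : Type*} [Field F]

/-- block weight -/
noncomputable def wt (d n : ℕ) : Fin d × Fin n → (Fin d →₀ ℕ) := fun v => Finsupp.single v.1 1

/-- power series in `t` whose `t^m` coefficient has multidegree `m` -/
noncomputable def grS (F : Type*) [Field F] (d n : ℕ) :
    Subring (MvPowerSeries (Fin d) (MvPolynomial (Fin d × Fin n) F)) where
  carrier := {f | ∀ m, IsWeightedHomogeneous (wt d n) (MvPowerSeries.coeff m f) m}
  mul_mem' := by
    intro f g hf hg m
    rw [MvPowerSeries.coeff_mul]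
    refine IsWeightedHomogeneous.sum _ _ _ fun x hx => ?_
    rw [← Finset.HasAntidiagonal.mem_antidiagonal.1 hx]
    exact (hf _).mul (hg _)
  one_mem' := by
    classical
    intro m
    rw [MvPowerSeries.coeff_one]
    split_ifs with h
    · rw [h]; exact isWeightedHomogeneous_one _ _
    · exact isWeightedHomogeneous_zero _ _ _
  add_mem' := by
    intro f g hf hg m
    rw [map_add]; exact (hf m).add (hg m)
  zero_mem' := by
    intro m
    rw [map_zero]; exact isWeightedHomogeneous_zero _ _ _
  neg_mem' := by
    intro f hf m
    rw [map_neg]; exact (hf m).neg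

theorem grS_C {d n : ℕ} (c : F) :
    MvPowerSeries.C (MvPolynomial.C c) ∈ grS F d n := by
  classical
  intro m
  rw [MvPowerSeries.coeff_C]
  split_ifs with h
  · rw [h]; exact isWeightedHomogeneous_C _ _
  · exact isWeightedHomogeneous_zero _ _ _

theorem grS_isUnit {d n : ℕ} (f : grS F d n) (c : F) (hc : c ≠ 0)
    (hf : MvPowerSeries.constantCoeff (f : MvPowerSeries (Fin d) (MvPolynomial (Fin d × Fin n) F))
      = MvPolynomial.C c) : IsUnit f := by
  classical
  let u : (MvPolynomial (Fin d × Fin n) F)ˣ :=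
    ⟨C c, C c⁻¹, by rw [← C_mul, mul_inv_cancel₀ hc, C_1], by rw [← C_mul, inv_mul_cancel₀ hc, C_1]⟩
  have hu : ((u⁻¹ : (MvPolynomial (Fin d × Fin n) F)ˣ) : MvPolynomial (Fin d × Fin n) F) = C c⁻¹ := rfl
  have hmem : MvPowerSeries.invOfUnit (f : MvPowerSeries (Fin d) (MvPolynomial (Fin d × Fin n) F)) u
      ∈ grS F d n := by
    intro m
    induction m using WellFoundedLT.induction with
    | ind m ih =>
    rw [MvPowerSeries.coeff_invOfUnit]
    split_ifs with h
    · rw [hu, h]; exact isWeightedHomogeneous_C _ _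
    · rw [hu, ← map_neg]
      refine IsWeightedHomogeneous.C_mul (IsWeightedHomogeneous.sum _ _ _ fun x hx => ?_) _
      split_ifs with h2
      · rw [← Finset.HasAntidiagonal.mem_antidiagonal.1 hx]
        exact (f.2 _).mul (ih _ h2)
      · exact isWeightedHomogeneous_zero _ _ _
  refine IsUnit.of_mul_eq_one ⟨_, hmem⟩ ?_
  ext1
  exact MvPowerSeries.mul_invOfUnit _ u hf

/-- Taylor shift `x_i ↦ p_i + t_i x_i`. -/
noncomputable def tay {d n : ℕ} (p : Fin d → Fin n → F) : MvPolynomial (Fin d × Fin n) F →+*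
    MvPowerSeries (Fin d) (MvPolynomial (Fin d × Fin n) F) :=
  eval₂Hom (MvPowerSeries.C.comp MvPolynomial.C) (fun v => MvPowerSeries.C (MvPolynomial.C (p v.1 v.2))
    + MvPowerSeries.monomial (Finsupp.single v.1 1) (X v))

theorem tay_C {d n : ℕ} (p : Fin d → Fin n → F) (c : F) :
    tay p (C c) = MvPowerSeries.C (MvPolynomial.C c) := by simp [tay]

theorem tay_X {d n : ℕ} (p : Fin d → Fin n → F) (v : Fin d × Fin n) :
    tay p (X v) = MvPowerSeries.C (MvPolynomial.C (p v.1 v.2))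
    + MvPowerSeries.monomial (Finsupp.single v.1 1) (X v) := by simp [tay]

theorem tay_mem {d n : ℕ} (p : Fin d → Fin n → F) (f : MvPolynomial (Fin d × Fin n) F) :
    tay p f ∈ grS F d n := by
  classical
  induction f using MvPolynomial.induction_on with
  | C a => rw [tay_C]; exact grS_C a
  | add f g hf hg => rw [map_add]; exact add_mem hf hg
  | mul_X f v hf =>
    rw [map_mul, tay_X]
    refine mul_mem hf (add_mem (grS_C _) ?_)
    intro m
    rw [MvPowerSeries.coeff_monomial]
    split_ifs with h
    · rw [h]; exact isWeightedHomogeneous_X _ _ _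
    · exact isWeightedHomogeneous_zero _ _ _

theorem tay_const {d n : ℕ} (p : Fin d → Fin n → F) (f : MvPolynomial (Fin d × Fin n) F) :
    MvPowerSeries.constantCoeff (tay p f) = C (eval (fun v => p v.1 v.2) f) := by
  classical
  induction f using MvPolynomial.induction_on with
  | C a => simp [tay_C]
  | add f g hf hg => simp [hf, hg]
  | mul_X f v hf =>
    have : MvPowerSeries.constantCoeff (MvPowerSeries.monomial (Finsupp.single v.1 1)
      (X v : MvPolynomial (Fin d × Fin n) F)) = 0 := by
      rw [← MvPowerSeries.coeff_zero_eq_constantCoeff_apply, MvPowerSeries.coeff_monomial, if_neg]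
      intro h
      have := DFunLike.congr_fun h v.1
      simp at this
    simp [hf, tay_X, this]

/-- `f` has degree at most `e`, with leading part `f`. -/
def topAt {d n : ℕ} (p : Fin d → Fin n → F) (e : Fin d →₀ ℕ) (f : MvPolynomial (Fin d × Fin n) F) :
    Prop :=
  (∀ m, ¬ m ≤ e → MvPowerSeries.coeff m (tay p f) = 0) ∧ MvPowerSeries.coeff e (tay p f) = f

theorem topAt_mul {d n : ℕ} (p : Fin d → Fin n → F) {e e' : Fin d →₀ ℕ}
    {f g : MvPolynomial (Fin d × Fin n) F} (hf : topAt p e f) (hg : topAt p e' g) :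
    topAt p (e + e') (f * g) := by
  classical
  constructor
  · intro m hm
    rw [map_mul, MvPowerSeries.coeff_mul]
    refine Finset.sum_eq_zero fun x hx => ?_
    rw [Finset.HasAntidiagonal.mem_antidiagonal] at hx
    by_cases h1 : x.1 ≤ e
    · by_cases h2 : x.2 ≤ e'
      · exact absurd (hx ▸ add_le_add h1 h2) hm
      · rw [hg.1 _ h2, mul_zero]
    · rw [hf.1 _ h1, zero_mul]
  · rw [map_mul, MvPowerSeries.coeff_mul, Finset.sum_eq_single (e, e')]
    · rw [hf.2, hg.2]
    · intro x hx hne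
      rw [Finset.HasAntidiagonal.mem_antidiagonal] at hx
      by_cases h1 : x.1 ≤ e
      · by_cases h2 : x.2 ≤ e'
        · exfalso
          apply hne
          have : ∀ i, x.1 i = e i ∧ x.2 i = e' i := by
            intro i
            have a1 := h1 i
            have a2 := h2 i
            have a3 := DFunLike.congr_fun hx i
            simp at a3
            omega
          exact Prod.ext (Finsupp.ext fun i => (this i).1) (Finsupp.ext fun i => (this i).2)
        · rw [hg.1 _ h2, mul_zero]
      · rw [hf.1 _ h1, zero_mul]
    · intro h; simp at h

theorem topAt_C {d n : ℕ} (p : Fin d → Fin n → F) (c : F) : topAt p 0 (C c : MvPolynomial (Fin d × Fin n) F) := by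
  classical
  constructor
  · intro m hm
    rw [tay_C, MvPowerSeries.coeff_C, if_neg]
    rintro rfl; exact hm le_rfl
  · rw [tay_C, MvPowerSeries.coeff_C, if_pos rfl]

theorem topAt_X {d n : ℕ} (p : Fin d → Fin n → F) (v : Fin d × Fin n) :
    topAt p (wt d n v) (X v : MvPolynomial (Fin d × Fin n) F) := by
  classical
  constructor
  · intro m hm
    rw [tay_X, map_add, MvPowerSeries.coeff_C, MvPowerSeries.coeff_monomial, if_neg, if_neg, add_zero]
    · rintro rfl; exact hm le_rfl
    · rintro rfl; exact hm zero_le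
  · rw [tay_X, map_add, MvPowerSeries.coeff_C, MvPowerSeries.coeff_monomial, if_neg, wt, if_pos rfl, zero_add]
    intro h
    have := DFunLike.congr_fun h v.1
    simp [wt] at this

theorem topAt_monomial {d n : ℕ} (p : Fin d → Fin n → F) (m : Fin d × Fin n →₀ ℕ) :
    topAt p (Finsupp.weight (wt d n) m) (monomial m (1 : F)) := by
  induction m using Finsupp.induction_linear with
  | zero => simpa using topAt_C (n := n) p 1
  | add f g hf hg =>
    rw [map_add, ← one_mul (1 : F), ← monomial_mul]
    exact topAt_mul p hf hg
  | single v k =>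
    induction k with
    | zero => simpa using topAt_C (n := n) p 1
    | succ k ih =>
      rw [Finsupp.single_add, map_add, ← one_mul (1 : F), ← monomial_mul]
      refine topAt_mul p ih ?_
      have := topAt_X p v
      rw [X] at this
      simpa [Finsupp.weight_single] using this

theorem tay_top {d n : ℕ} (p : Fin d → Fin n → F) (e : Fin d →₀ ℕ)
    (f : MvPolynomial (Fin d × Fin n) F) (hf : IsWeightedHomogeneous (wt d n) f e) :
    MvPowerSeries.coeff e (tay p f) = f := by
  conv_rhs => rw [f.as_sum]
  conv_lhs => rw [f.as_sum]
  rw [map_sum, map_sum]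
  refine Finset.sum_congr rfl fun m hm => ?_
  have h1 : Finsupp.weight (wt d n) m = e := hf (by simpa using hm)
  have h2 := topAt_mul p (topAt_C (n := n) p (coeff m f)) (topAt_monomial p m)
  rw [C_mul_monomial, mul_one, zero_add, h1] at h2
  exact h2.2

/-- kill the variables of blocks in `S` -/
noncomputable def kill {d n : ℕ} (S : Finset (Fin d)) : MvPolynomial (Fin d × Fin n) F →+*
    MvPolynomial (Fin d × Fin n) F :=
  (aeval (R := F) (fun v : Fin d × Fin n => if v.1 ∈ S then 0 else X v)).toRingHom

theorem kill_hom {d n : ℕ} (S : Finset (Fin d)) (e : Fin d →₀ ℕ)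
    (f : MvPolynomial (Fin d × Fin n) F) (hf : IsWeightedHomogeneous (wt d n) f e) :
    kill S f = if Disjoint S e.support then f else 0 := by
  have key : ∀ m ∈ f.support, kill S (monomial m (coeff m f)) =
      if Disjoint S e.support then monomial m (coeff m f) else 0 := by
    intro m hm
    have h1 : Finsupp.weight (wt d n) m = e := hf (by simpa using hm)
    have h1' : ∀ i, e i = ∑ j, m (i, j) := by
      intro i
      rw [← h1, Finsupp.weight_apply, Finsupp.sum_fintype _ _ (by simp), Finsupp.finsetSum_apply,
        Fintype.sum_prod_type]
      simp [wt, Finsupp.single_apply]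
    have h2 : kill S (monomial m (coeff m f)) =
      C (coeff m f) * m.prod fun v k => (if v.1 ∈ S then 0 else X v) ^ k := by
      exact aeval_monomial _ _ _
    rw [h2]
    split_ifs with hd
    · rw [monomial_eq]
      congr 1
      refine Finsupp.prod_congr fun v hv => ?_
      rw [if_neg]
      intro hS
      refine (Finset.disjoint_left.1 hd hS) ?_
      rw [Finsupp.mem_support_iff, h1']
      intro h0
      rw [Finset.sum_eq_zero_iff] at h0
      exact (Finsupp.mem_support_iff.1 hv) (h0 v.2 (Finset.mem_univ _))
    · rw [Finset.not_disjoint_iff] at hd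
      obtain ⟨i, hiS, hi⟩ := hd
      rw [Finsupp.mem_support_iff, h1'] at hi
      obtain ⟨j, -, hj⟩ := Finset.exists_ne_zero_of_sum_ne_zero hi
      rw [Finsupp.prod, Finset.prod_eq_zero (i := (i, j)) (by simpa using hj), mul_zero]
      simp [hiS, hj]
  conv_lhs => rw [f.as_sum]
  rw [map_sum, Finset.sum_congr rfl key]
  split_ifs
  · exact f.as_sum.symm
  · simp

theorem kill_tay {d n : ℕ} (p : Fin d → Fin n → F) (S : Finset (Fin d))
    (f : MvPolynomial (Fin d × Fin n) F) :
    MvPowerSeries.map (kill S) (tay p f) =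
      tay p (aeval (fun v : Fin d × Fin n => if v.1 ∈ S then C (p v.1 v.2) else X v) f) := by
  induction f using MvPolynomial.induction_on with
  | C a => simp [tay_C, kill]
  | add f g hf hg => simp [hf, hg]
  | mul_X f v hf =>
    have h : MvPowerSeries.map (kill S) (tay p (X v)) =
      tay p (aeval (fun v : Fin d × Fin n => if v.1 ∈ S then C (p v.1 v.2) else X v)
        (X v : MvPolynomial (Fin d × Fin n) F)) := by
      rw [aeval_X]
      by_cases h : v.1 ∈ S
      · simp [tay_X, tay_C, kill, h]
      · simp [tay_X, kill, h]
    rw [map_mul (tay p), map_mul (MvPowerSeries.map (kill S)), hf, h, map_mul (aeval _),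
      map_mul (tay p)]

end PS

section Main
variable {F : Type*} [Field F]

theorem wt_apply {d n : ℕ} (m : Fin d × Fin n →₀ ℕ) (i : Fin d) :
    Finsupp.weight (wt d n) m i = ∑ j, m (i, j) := by
  rw [Finsupp.weight_apply, Finsupp.sum_fintype _ _ (by simp), Finsupp.finsetSum_apply,
    Fintype.sum_prod_type]
  simp [wt, Finsupp.single_apply]

theorem ml_iff {d n : ℕ} (S : Finset (Fin d)) (e : Fin d →₀ ℕ)
    (he : ∀ i, e i = if i ∈ S then 1 else 0) (f : MvPolynomial (Fin d × Fin n) F) :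
    IsMultilinearOn S f ↔ IsWeightedHomogeneous (wt d n) f e := by
  constructor
  · intro h m hm
    ext i
    rw [wt_apply, he]
    exact h m (by simpa using hm) i
  · intro h m hm i
    rw [← he, ← wt_apply, h (by simpa using hm)]

/-- the all-ones exponent -/
noncomputable def ones (d : ℕ) : Fin d →₀ ℕ := Finsupp.equivFunOnFinite.symm fun _ => 1

theorem ones_apply {d : ℕ} (i : Fin d) : ones d i = 1 := rfl

theorem incl_excl {d n : ℕ} (f : grS F d n) (m : Fin d →₀ ℕ) :
    MvPowerSeries.coeff m (∑ S : Finset (Fin d), (-1) ^ S.card * MvPowerSeries.map (kill S)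
      (f : MvPowerSeries (Fin d) (MvPolynomial (Fin d × Fin n) F))) =
    if ones d ≤ m then MvPowerSeries.coeff m
      (f : MvPowerSeries (Fin d) (MvPolynomial (Fin d × Fin n) F)) else 0 := by
  classical
  have h1 : ∀ S : Finset (Fin d), MvPowerSeries.coeff m ((-1) ^ S.card * MvPowerSeries.map (kill S)
      (f : MvPowerSeries (Fin d) (MvPolynomial (Fin d × Fin n) F))) =
      if S ∈ (m.supportᶜ).powerset then ((-1 : ℤ) ^ S.card) • MvPowerSeries.coeff m
        (f : MvPowerSeries (Fin d) (MvPolynomial (Fin d × Fin n) F)) else 0 := by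
    intro S
    have : ((-1) ^ S.card * MvPowerSeries.map (kill S)
      (f : MvPowerSeries (Fin d) (MvPolynomial (Fin d × Fin n) F))) =
      ((-1 : ℤ) ^ S.card) • MvPowerSeries.map (kill S)
      (f : MvPowerSeries (Fin d) (MvPolynomial (Fin d × Fin n) F)) := by
      simp [zsmul_eq_mul]
    rw [this, map_zsmul, MvPowerSeries.coeff_map, kill_hom S m _ (f.2 m)]
    simp only [Finset.mem_powerset, Finset.subset_compl_iff_disjoint_right]
    split_ifs <;> simp
  rw [map_sum, Finset.sum_congr rfl fun S _ => h1 S, Finset.sum_ite_mem, Finset.univ_inter,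
    ← Finset.sum_smul, Finset.sum_powerset_neg_one_pow_card]
  have h2 : (m.supportᶜ = ∅) ↔ ones d ≤ m := by
    rw [Finset.compl_eq_empty_iff, Finset.eq_univ_iff_forall, Finsupp.le_def]
    refine forall_congr' fun i => ?_
    rw [Finsupp.mem_support_iff, ones_apply]; omega
  simp only [h2]
  split_ifs <;> simp

theorem rank_bound {d n a b : ℕ} (Sc : Matrix (Fin a) (Fin b) (grS F d n)) :
    CR (Matrix.of fun i j => MvPowerSeries.coeff (ones d)
      (Sc i j : MvPowerSeries (Fin d) (MvPolynomial (Fin d × Fin n) F))) ≤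
    ∑ S : Finset (Fin d), ((Sc.map ((MvPowerSeries.map (kill S)).comp (grS F d n).subtype)).map
      (algebraMap (MvPowerSeries (Fin d) (MvPolynomial (Fin d × Fin n) F))
        (FractionRing (MvPowerSeries (Fin d) (MvPolynomial (Fin d × Fin n) F))))).rank := by
  classical
  set P := MvPowerSeries (Fin d) (MvPolynomial (Fin d × Fin n) F) with hP
  set L := FractionRing P
  let W : Matrix (Fin a) (Fin b) P := Matrix.of fun i j => fun m =>
    MvPowerSeries.coeff (ones d + m) (Sc i j : P)
  have hW : ∀ i j m, MvPowerSeries.coeff m (W i j) = MvPowerSeries.coeff (ones d + m) (Sc i j : P) :=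
    fun i j m => rfl
  have h1 : (Matrix.of fun i j => MvPowerSeries.coeff (ones d) (Sc i j : P)) =
      W.map (MvPowerSeries.constantCoeff) := by
    ext1 i j
    rw [Matrix.map_apply, ← MvPowerSeries.coeff_zero_eq_constantCoeff_apply, hW, add_zero]
    rfl
  let τ : P := MvPowerSeries.monomial (ones d) 1
  have hτ : τ ≠ 0 := by
    intro h
    have := congrArg (MvPowerSeries.coeff (ones d)) h
    simp [τ] at this
  have hτ' : algebraMap P L τ ≠ 0 := by
    rw [Ne, map_eq_zero_iff _ (IsFractionRing.injective P L)]; exact hτ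
  have h2 : ∀ i j, τ * W i j = ∑ S : Finset (Fin d), (-1) ^ S.card * MvPowerSeries.map (kill S)
      (Sc i j : P) := by
    intro i j
    apply MvPowerSeries.ext
    intro m
    rw [incl_excl, MvPowerSeries.coeff_monomial_mul]
    split_ifs with h
    · rw [hW, one_mul, add_tsub_cancel_of_le h]
    · rfl
  have h3 : W.map (algebraMap P L) = (algebraMap P L τ)⁻¹ • ∑ S : Finset (Fin d),
      ((-1 : L) ^ S.card) • (Sc.map ((MvPowerSeries.map (kill S)).comp (grS F d n).subtype)).map
      (algebraMap P L) := by
    rw [eq_inv_smul_iff₀ hτ']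
    ext i j
    have := congrArg (algebraMap P L) (h2 i j)
    rw [map_mul, map_sum] at this
    rw [Matrix.smul_apply, Matrix.map_apply, smul_eq_mul, this, Matrix.sum_apply]
    refine Finset.sum_congr rfl fun S _ => ?_
    rw [map_mul, map_pow, map_neg, map_one]
    rfl
  rw [h1]
  calc CR (W.map (MvPowerSeries.constantCoeff)) ≤ (W.map (algebraMap P L)).rank :=
        aux_rank_map (algebraMap P L) (IsFractionRing.injective P L) _ _ W
    _ ≤ _ := by
        rw [h3]
        refine (aux_rank_smul _ _).trans ((aux_rank_sum _ _).trans ?_)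
        exact Finset.sum_le_sum fun S _ => aux_rank_smul _ _

theorem PR_bound {d n a b r : ℕ} (A : Matrix (Fin a) (Fin r) (grS F d n))
    (B : Matrix (Fin r) (Fin b) (grS F d n)) :
    PR (Matrix.of fun i j => MvPowerSeries.coeff (ones d)
      ((A * B) i j : MvPowerSeries (Fin d) (MvPolynomial (Fin d × Fin n) F))) ≤ 2 ^ d * r := by
  classical
  let I := (Finset.HasAntidiagonal.antidiagonal (ones d))
  have hI : I.card ≤ 2 ^ d := by
    have : I.card ≤ (Finset.univ : Finset (Finset (Fin d))).card := by
      refine Finset.card_le_card_of_injOn (fun x => x.1.support) (by simp) ?_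
      intro x hx y hy hxy
      have hx' := Finset.HasAntidiagonal.mem_antidiagonal.1 hx
      have hy' := Finset.HasAntidiagonal.mem_antidiagonal.1 hy
      have : ∀ i, x.1 i = y.1 i ∧ x.2 i = y.2 i := by
        intro i
        have a1 := DFunLike.congr_fun hx' i
        have a2 := DFunLike.congr_fun hy' i
        have a3 := Finset.ext_iff.1 hxy i
        simp only [Finsupp.mem_support_iff, Finsupp.add_apply, ones_apply] at a1 a2 a3
        omega
      exact Prod.ext (Finsupp.ext fun i => (this i).1) (Finsupp.ext fun i => (this i).2)
    simpa using this
  have hd : HasPRDecomp (Matrix.of fun i j => MvPowerSeries.coeff (ones d)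
      ((A * B) i j : MvPowerSeries (Fin d) (MvPolynomial (Fin d × Fin n) F)))
      (Fintype.card (I × Fin r)) := by
    let q := (Fintype.equivFin (I × Fin r)).symm
    refine ⟨fun t => (q t).1.1.1.support,
      fun t i => MvPowerSeries.coeff (q t).1.1.1 (A i (q t).2).1,
      fun t j => MvPowerSeries.coeff (q t).1.1.2 (B (q t).2 j).1, ?_, ?_, ?_⟩
    · intro t i
      rw [ml_iff _ (q t).1.1.1]
      · exact (A i (q t).2).2 _
      · intro i
        have a1 := DFunLike.congr_fun (Finset.HasAntidiagonal.mem_antidiagonal.1 (q t).1.2) i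
        simp only [Finsupp.mem_support_iff, Finsupp.add_apply, ones_apply] at a1 ⊢
        split_ifs <;> omega
    · intro t j
      rw [ml_iff _ (q t).1.1.2]
      · exact (B (q t).2 j).2 _
      · intro i
        have a1 := DFunLike.congr_fun (Finset.HasAntidiagonal.mem_antidiagonal.1 (q t).1.2) i
        simp only [Finset.mem_compl, Finsupp.mem_support_iff, Finsupp.add_apply, ones_apply] at a1 ⊢
        split_ifs <;> omega
    · ext1 i j
      rw [Matrix.sum_apply]
      simp only [Matrix.of_apply]
      rw [Equiv.sum_comp q (fun z => MvPowerSeries.coeff z.1.1.1 (A i z.2).1 *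
        MvPowerSeries.coeff z.1.1.2 (B z.2 j).1), Fintype.sum_prod_type_right]
      rw [Matrix.mul_apply, AddSubmonoidClass.coe_finsetSum, map_sum]
      refine Finset.sum_congr rfl fun k _ => ?_
      rw [Subring.coe_mul, MvPowerSeries.coeff_mul]
      exact (Finset.sum_coe_sort I (fun z => MvPowerSeries.coeff z.1 (A i k).1 *
        MvPowerSeries.coeff z.2 (B k j).1)).symm
  refine (Nat.sInf_le hd).trans ?_
  simp only [Fintype.card_prod, Fintype.card_coe, Fintype.card_fin]
  exact Nat.mul_le_mul_right _ hI

end Main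

/-- Differential Schur complement: given `M`, `p`, and
`r = rank M(p)`, there is a matrix `N` of multilinear forms with
`PR(M − N) ≤ 2^d r` and `CR(N) ≤ ∑_{S ⊊ [d]} (CR(M[p_S]) − r)`. -/
theorem statement_13 (F : Type*) [Field F] (d n a b : ℕ) (hn : 1 ≤ n)
    (M : Matrix (Fin a) (Fin b) (MvPolynomial (Fin d × Fin n) F))
    (hM : ∀ i j, IsMultilinear (M i j))
    (p : Fin d → Fin n → F) (r : ℕ) (hr : (evalMat M p).rank = r) :
    ∃ N : Matrix (Fin a) (Fin b) (MvPolynomial (Fin d × Fin n) F),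
      (∀ i j, IsMultilinear (N i j)) ∧
      PR (M - N) ≤ 2 ^ d * r ∧
      (CR N : ℤ) ≤ ∑ S ∈ (Finset.univ : Finset (Finset (Fin d))).erase Finset.univ,
        ((CR (pevalMat M S p) : ℤ) - (r : ℤ)) := by
  classical
  obtain ⟨e, f, hdet⟩ := aux_minor _ hr
  let φ : MvPolynomial (Fin d × Fin n) F →+* grS F d n := (tay p).codRestrict (grS F d n) (tay_mem p)
  let MG : Matrix (Fin a) (Fin b) (grS F d n) := M.map φ
  have hunit : IsUnit (MG.submatrix e f).det := by
    refine grS_isUnit _ _ hdet ?_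
    have h1 : MG.submatrix e f = φ.mapMatrix (M.submatrix e f) := by ext; rfl
    have h2 : (evalMat M p).submatrix e f =
      (eval fun v : Fin d × Fin n => p v.1 v.2).mapMatrix (M.submatrix e f) := by ext; rfl
    rw [h1, h2, ← RingHom.map_det, ← RingHom.map_det]
    exact tay_const p _
  let E := (MG.submatrix e f)⁻¹
  have hE : MG.submatrix e f * E = 1 := Matrix.mul_nonsing_inv _ hunit
  let Q := MG.submatrix id f * E * MG.submatrix e id
  let Sc := MG - Q
  let P := MvPowerSeries (Fin d) (MvPolynomial (Fin d × Fin n) F)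
  let L := FractionRing P
  have hones : ∀ i : Fin d, ones d i = if i ∈ Finset.univ then 1 else 0 := by
    intro i; simp [ones_apply]
  -- rank of each specialised Schur complement
  have hS : ∀ S : Finset (Fin d),
      ((Sc.map ((MvPowerSeries.map (kill S)).comp (grS F d n).subtype)).map (algebraMap P L)).rank
        + r ≤ CR (pevalMat M S p) := by
    intro S
    let g : grS F d n →+* L :=
      (algebraMap P L).comp ((MvPowerSeries.map (kill S)).comp (grS F d n).subtype)
    have h1 : (Sc.map ((MvPowerSeries.map (kill S)).comp (grS F d n).subtype)).map (algebraMap P L)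
        = MG.map g - (MG.map g).submatrix id f * E.map g * (MG.map g).submatrix e id := by
      have : (Sc.map ((MvPowerSeries.map (kill S)).comp (grS F d n).subtype)).map (algebraMap P L)
        = Sc.map g := by ext; rfl
      rw [this]
      simp only [Sc, Q]
      rw [Matrix.map_sub _ (map_sub g), Matrix.map_mul, Matrix.map_mul]
      rfl
    have h2 : (MG.map g).submatrix e f * E.map g = 1 := by
      have : (MG.map g).submatrix e f = (MG.submatrix e f).map g := rfl
      rw [this, ← Matrix.map_mul, hE, Matrix.map_one _ (map_zero g) (map_one g)]
    rw [h1]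
    refine (aux_wedderburn _ e f _ h2).trans ?_
    have h3 : MG.map g = ((pevalMat M S p).map (tay p)).map (algebraMap P L) := by
      ext i j
      exact congrArg (algebraMap P L) (kill_tay p S (M i j))
    rw [h3]
    exact aux_rank_map _ (IsFractionRing.injective _ _) _ _ _
  have huniv : CR (pevalMat M Finset.univ p) ≤ r := by
    have : pevalMat M Finset.univ p = (evalMat M p).map (C : F →+* MvPolynomial (Fin d × Fin n) F) := by
      ext1 i j
      simp only [pevalMat, evalMat, Matrix.map_apply, Finset.mem_univ, if_true]
      induction M i j using MvPolynomial.induction_on with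
      | C a => simp
      | add f g hf hg => simp only [map_add, hf, hg]
      | mul_X f v hf => simp only [map_mul, hf, aeval_X, eval_X]
    rw [this, ← hr]
    have := aux_rank_map (RingHom.id F) Function.injective_id
      (algebraMap (MvPolynomial (Fin d × Fin n) F) (FractionRing (MvPolynomial (Fin d × Fin n) F)))
      C (evalMat M p)
    simpa [CR] using this
  refine ⟨Matrix.of fun i j => MvPowerSeries.coeff (ones d) (Sc i j : P), ?_, ?_, ?_⟩
  · intro i j
    exact (ml_iff _ _ hones _).2 ((Sc i j).2 _)
  · have : M - (Matrix.of fun i j => MvPowerSeries.coeff (ones d) (Sc i j : P)) =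
        Matrix.of fun i j => MvPowerSeries.coeff (ones d) (Q i j : P) := by
      ext1 i j
      have h1 : MvPowerSeries.coeff (ones d) (MG i j : P) = M i j :=
        tay_top p _ _ ((ml_iff _ _ hones _).1 (hM i j))
      have h2 : (Sc i j : P) = (MG i j : P) - (Q i j : P) := rfl
      rw [Matrix.sub_apply, Matrix.of_apply, Matrix.of_apply, h2, map_sub, h1, sub_sub_cancel]
    rw [this]
    exact PR_bound _ _
  · have h1 := rank_bound Sc
    rw [← Finset.add_sum_erase _ _ (Finset.mem_univ (Finset.univ : Finset (Fin d)))] at h1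
    have h0 := hS Finset.univ
    have h2 : CR (Matrix.of fun i j => MvPowerSeries.coeff (ones d) (Sc i j : P)) ≤
      ∑ S ∈ (Finset.univ : Finset (Finset (Fin d))).erase Finset.univ,
      ((Sc.map ((MvPowerSeries.map (kill S)).comp (grS F d n).subtype)).map (algebraMap P L)).rank := by
      refine h1.trans ?_
      have : ((Sc.map ((MvPowerSeries.map (kill Finset.univ)).comp (grS F d n).subtype)).map
        (algebraMap P L)).rank = 0 := by omega
      exact le_of_eq (by rw [this, zero_add])
    refine (Int.ofNat_le.2 h2).trans ?_
    rw [Nat.cast_sum]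
    refine Finset.sum_le_sum fun S _ => ?_
    have := hS S
    omega
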